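/- A QC code C with CRT decomposition C ≅ (⊕_i C_i) ⊕ (⊕_t (C'_t ⊕ C''_t)) is Euclidean self-dual if and only if C_i = C_i^{⊥_G} (Hermitian, or Euclidean in the exceptional cases) for all i and C''_t = (C'_t)^{⊥_e} for all t; and C is Euclidean LCD if and only if C_i ∩ C_i^{⊥_G} = {0} for all i and C'_t ∩ (C''_t)^{⊥_e} = {0} and C''_t ∩ (C'_t)^{⊥_e} = {0} for all t. -/

import Mathlib

set_option maxHeartbeats 1000000

open Polynomial

/-- The polynomial of a length-`m` vector. -/
noncomputable def toPoly {F : Type*} [Field F] {m : ℕ} (v : Fin m → F) : Polynomial F :=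
  ∑ k : Fin m, C (v k) * X ^ (k : ℕ)

/-- The natural reduction map `F[x]/⟨f₁⟩ → F[x]/⟨f₂⟩` when `f₂ ∣ f₁`. -/
noncomputable def projMod {F : Type*} [Field F] (f₁ f₂ : Polynomial F) (h : f₂ ∣ f₁) :
    AdjoinRoot f₁ →+* AdjoinRoot f₂ :=
  AdjoinRoot.lift (AdjoinRoot.of f₂) (AdjoinRoot.root f₂) (by
    have h0 : (AdjoinRoot.mk f₂) f₁ = 0 := AdjoinRoot.mk_eq_zero.mpr h
    rwa [← AdjoinRoot.aeval_eq, Polynomial.aeval_def] at h0)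

/-- A codeword array, viewed as an element of `R^ℓ` via column polynomials. -/
noncomputable def toR {F : Type*} [Field F] {m ℓ : ℕ} (c : Fin m → Fin ℓ → F) :
    Fin ℓ → AdjoinRoot (X ^ m - C 1 : Polynomial F) :=
  fun j => AdjoinRoot.mk _ (toPoly fun i => c i j)

/-- The set of codeword arrays of a QC code `Cs ⊆ R^ℓ`. -/
noncomputable def arrSet {F : Type*} [Field F] {m ℓ : ℕ}
    (Cs : Submodule (AdjoinRoot (X ^ m - C 1 : Polynomial F))
      (Fin ℓ → AdjoinRoot (X ^ m - C 1 : Polynomial F))) : Set (Fin m → Fin ℓ → F) :=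
  {c | toR c ∈ Cs}

/-- The Euclidean dual of a QC code, at the level of `m × ℓ` arrays over `F`. -/
noncomputable def dualArr {F : Type*} [Field F] {m ℓ : ℕ}
    (Cs : Submodule (AdjoinRoot (X ^ m - C 1 : Polynomial F))
      (Fin ℓ → AdjoinRoot (X ^ m - C 1 : Polynomial F))) : Set (Fin m → Fin ℓ → F) :=
  {d | ∀ c ∈ arrSet Cs, ∑ i, ∑ j, c i j * d i j = 0}

/-- The constituent of a set of codeword arrays at an irreducible factor `f₂` of
`x^m − 1`: the image of the code in `(F[x]/⟨f₂⟩)^ℓ` under reduction mod `f₂`. -/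
noncomputable def constSet {F : Type*} [Field F] {m ℓ : ℕ} (f₂ : Polynomial F)
    (h : f₂ ∣ X ^ m - C 1) (S : Set (Fin m → Fin ℓ → F)) :
    Set (Fin ℓ → AdjoinRoot f₂) :=
  (fun c => fun j => projMod (X ^ m - C 1) f₂ h (toR c j)) '' S


namespace QCaux

variable {F : Type*} [Field F]

lemma projMod_mk (f₁ f₂ : F[X]) (h : f₂ ∣ f₁) (P : F[X]) :
    projMod f₁ f₂ h (AdjoinRoot.mk f₁ P) = AdjoinRoot.mk f₂ P := by
  refine (AdjoinRoot.lift_mk _ _).trans ?_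
  rw [← AdjoinRoot.aeval_eq, Polynomial.aeval_def]
  rfl

lemma projMod_of (f₁ f₂ : F[X]) (h : f₂ ∣ f₁) (x : F) :
    projMod f₁ f₂ h (AdjoinRoot.of f₁ x) = AdjoinRoot.of f₂ x :=
  projMod_mk _ _ h (C x)

lemma projMod_root (f₁ f₂ : F[X]) (h : f₂ ∣ f₁) :
    projMod f₁ f₂ h (AdjoinRoot.root f₁) = AdjoinRoot.root f₂ :=
  projMod_mk _ _ h X

lemma projMod_surj (f₁ f₂ : F[X]) (h : f₂ ∣ f₁) : Function.Surjective (projMod f₁ f₂ h) := by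
  intro x
  induction x using AdjoinRoot.induction_on with
  | _ P => exact ⟨AdjoinRoot.mk f₁ P, projMod_mk _ _ _ _⟩

lemma root_pow_of_dvd {m : ℕ} (f : F[X]) (h : f ∣ X ^ m - C 1) :
    (AdjoinRoot.root f) ^ m = 1 := by
  have h0 : (AdjoinRoot.mk f) (X ^ m - C 1) = 0 := AdjoinRoot.mk_eq_zero.mpr h
  rw [map_sub, map_pow, AdjoinRoot.mk_X, C_1, map_one, sub_eq_zero] at h0
  exact h0

/-- conjugation -/
noncomputable def bar (F : Type*) [Field F] (m : ℕ) :
    AdjoinRoot (X ^ m - C 1 : F[X]) →+* AdjoinRoot (X ^ m - C 1 : F[X]) :=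
  AdjoinRoot.lift (AdjoinRoot.of _) ((AdjoinRoot.root _) ^ (m - 1)) (by
    rw [eval₂_sub, eval₂_pow, eval₂_X, eval₂_C, ← pow_mul, mul_comm, pow_mul,
      root_pow_of_dvd _ dvd_rfl]; simp)

lemma bar_of (m : ℕ) (x : F) : bar F m (AdjoinRoot.of _ x) = AdjoinRoot.of _ x := by
  simp [bar]

lemma bar_root (m : ℕ) : bar F m (AdjoinRoot.root _) = (AdjoinRoot.root _) ^ (m - 1) := by
  simp [bar]

lemma monic_f {m : ℕ} (hm : 0 < m) : (X ^ m - C 1 : F[X]).Monic :=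
  monic_X_pow_sub_C _ hm.ne'

/-- constant coefficient functional -/
noncomputable def eps {m : ℕ} (hm : 0 < m) : AdjoinRoot (X ^ m - C 1 : F[X]) →ₗ[F] F :=
  (Polynomial.lcoeff F 0).comp (AdjoinRoot.modByMonicHom (monic_f hm))

lemma eps_root_pow {m : ℕ} (hm : 0 < m) {k : ℕ} (hk : k < m) :
    eps (F := F) hm ((AdjoinRoot.root _) ^ k) = if k = 0 then 1 else 0 := by
  have : (AdjoinRoot.root (X ^ m - C 1 : F[X])) ^ k = AdjoinRoot.mk _ (X ^ k) := by simp
  rw [this, eps, LinearMap.comp_apply, AdjoinRoot.modByMonicHom_mk,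
    (modByMonic_eq_self_iff (monic_f hm)).2]
  · simp [coeff_X_pow, eq_comm]
  · rw [degree_X_pow, degree_X_pow_sub_C hm]; exact_mod_cast hk

lemma eps_pair {m : ℕ} (hm : 0 < m) (i k : Fin m) :
    eps (F := F) hm ((AdjoinRoot.root _) ^ (i : ℕ) * ((AdjoinRoot.root _) ^ (m - 1)) ^ (k : ℕ)) =
      if i = k then 1 else 0 := by
  have hr := root_pow_of_dvd (X ^ m - C 1 : F[X]) dvd_rfl
  set r := AdjoinRoot.root (X ^ m - C 1 : F[X])
  have hr1 : r * r ^ (m - 1) = 1 := by rw [← pow_succ', Nat.sub_add_cancel hm, hr]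
  have hi := i.2
  have hk := k.2
  rcases le_or_gt (k : ℕ) i with hki | hki
  · obtain ⟨a, ha⟩ := Nat.exists_eq_add_of_le hki
    have : r ^ (i : ℕ) * (r ^ (m - 1)) ^ (k : ℕ) = r ^ a := by
      rw [ha, pow_add, mul_right_comm, ← mul_pow, hr1, one_pow, one_mul]
    rw [this, eps_root_pow hm (by omega)]
    congr 1
    simp only [Fin.ext_iff, eq_iff_iff]; omega
  · obtain ⟨a, ha⟩ := Nat.exists_eq_add_of_lt hki
    have : r ^ (i : ℕ) * (r ^ (m - 1)) ^ (k : ℕ) = r ^ (m - (a + 1)) := by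
      have h2 : r ^ (m - (a + 1)) * r ^ (a + 1) = 1 := by
        rw [← pow_add, Nat.sub_add_cancel (by omega), hr]
      have : (k : ℕ) = i + (a + 1) := by omega
      rw [this, pow_add, ← mul_assoc, ← mul_pow, hr1, one_pow, one_mul]
      calc (r ^ (m - 1)) ^ (a + 1) = (r ^ (m - (a + 1)) * r ^ (a + 1)) * (r ^ (m - 1)) ^ (a + 1) := by
            rw [h2, one_mul]
        _ = r ^ (m - (a + 1)) := by rw [mul_assoc, ← mul_pow, hr1, one_pow, mul_one]
    rw [this, eps_root_pow hm (by omega)]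
    congr 1
    simp only [Fin.ext_iff, eq_iff_iff]; omega

lemma mk_toPoly {m : ℕ} (v : Fin m → F) :
    AdjoinRoot.mk (X ^ m - C 1 : F[X]) (toPoly v) =
      ∑ k : Fin m, v k • (AdjoinRoot.root (X ^ m - C 1 : F[X])) ^ (k : ℕ) := by
  simp [toPoly, map_sum, Algebra.smul_def, AdjoinRoot.algebraMap_eq]

lemma bar_mk_toPoly {m : ℕ} (v : Fin m → F) :
    bar F m (AdjoinRoot.mk (X ^ m - C 1 : F[X]) (toPoly v)) =
      ∑ k : Fin m, v k • ((AdjoinRoot.root (X ^ m - C 1 : F[X])) ^ (m - 1)) ^ (k : ℕ) := by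
  simp only [mk_toPoly, map_sum, Algebra.smul_def, AdjoinRoot.algebraMap_eq, map_mul, map_pow,
    bar_of, bar_root]

lemma eps_dot {m : ℕ} (hm : 0 < m) (v w : Fin m → F) :
    eps hm (AdjoinRoot.mk (X ^ m - C 1 : F[X]) (toPoly v) *
      bar F m (AdjoinRoot.mk (X ^ m - C 1 : F[X]) (toPoly w))) = ∑ k, v k * w k := by
  rw [mk_toPoly, bar_mk_toPoly, Finset.sum_mul_sum, map_sum]
  refine Finset.sum_congr rfl fun i _ => ?_
  rw [map_sum]
  simp only [smul_mul_smul_comm, map_smul, eps_pair hm]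
  simp

lemma toPoly_surj {m : ℕ} (hm : 0 < m) (r : AdjoinRoot (X ^ m - C 1 : F[X])) :
    ∃ v : Fin m → F, AdjoinRoot.mk _ (toPoly v) = r := by
  refine ⟨fun i => (AdjoinRoot.modByMonicHom (monic_f hm) r).coeff i, ?_⟩
  induction r using AdjoinRoot.induction_on with
  | _ P =>
    rw [AdjoinRoot.modByMonicHom_mk]
    have hlt : (P %ₘ (X ^ m - C 1)).natDegree < m := by
      have := natDegree_modByMonic_lt P (monic_f (F := F) hm) (by
        intro h
        have := congrArg natDegree h
        rw [natDegree_X_pow_sub_C] at this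
        simp at this; omega)
      rwa [natDegree_X_pow_sub_C] at this
    have : toPoly (fun i : Fin m => (P %ₘ (X ^ m - C 1)).coeff i) = P %ₘ (X ^ m - C 1) := by
      rw [toPoly, Fin.sum_univ_eq_sum_range (fun i => C ((P %ₘ (X ^ m - C 1)).coeff i) * X ^ i)]
      exact (as_sum_range_C_mul_X_pow' _ hlt).symm
    rw [this]
    nth_rewrite 2 [← modByMonic_add_div P (X ^ m - C 1)]
    rw [map_add, map_mul, AdjoinRoot.mk_self, zero_mul, add_zero]

lemma eps_nondeg {m : ℕ} (hm : 0 < m) (a : AdjoinRoot (X ^ m - C 1 : F[X]))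
    (h : ∀ r, eps hm (r * a) = 0) : a = 0 := by
  obtain ⟨v, rfl⟩ := toPoly_surj hm a
  have : v = 0 := by
    funext k
    have := h (((AdjoinRoot.root _) ^ (m - 1)) ^ (k : ℕ))
    rw [mk_toPoly, mul_comm, Finset.sum_mul, map_sum] at this
    simpa only [Pi.zero_apply, smul_mul_assoc, map_smul, eps_pair hm, smul_eq_mul, mul_ite, mul_one, mul_zero,
      Finset.sum_ite_eq', Finset.mem_univ, if_true] using this
  rw [mk_toPoly, this]; simp

lemma toR_surj {m ℓ : ℕ} (hm : 0 < m) (u : Fin ℓ → AdjoinRoot (X ^ m - C 1 : F[X])) :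
    ∃ c : Fin m → Fin ℓ → F, toR c = u := by
  choose v hv using fun j => toPoly_surj hm (u j)
  exact ⟨fun i j => v j i, funext fun j => hv j⟩

lemma toR_zero {m ℓ : ℕ} : toR (0 : Fin m → Fin ℓ → F) = 0 := by
  funext j
  simp only [toR, mk_toPoly]; simp

lemma toR_eq_zero {m ℓ : ℕ} (hm : 0 < m) {c : Fin m → Fin ℓ → F} (h : toR c = 0) : c = 0 := by
  funext i j
  have h1 : AdjoinRoot.mk _ (toPoly fun i => c i j) = 0 := congrFun h j
  have h2 := eps_dot hm (fun i => c i j) (Pi.single i 1)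
  rw [h1] at h2
  simpa [Pi.single_apply] using h2.symm

lemma mem_dualArr {m ℓ : ℕ} (hm : 0 < m)
    (Cs : Submodule (AdjoinRoot (X ^ m - C 1 : F[X])) (Fin ℓ → AdjoinRoot (X ^ m - C 1 : F[X])))
    (d : Fin m → Fin ℓ → F) :
    d ∈ dualArr Cs ↔ ∀ c ∈ arrSet Cs, ∑ j, toR c j * bar F m (toR d j) = 0 := by
  have key : ∀ c, ∑ i, ∑ j, c i j * d i j = eps hm (∑ j, toR c j * bar F m (toR d j)) := by
    intro c
    rw [map_sum, Finset.sum_comm]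
    exact Finset.sum_congr rfl fun j _ => (eps_dot hm _ _).symm
  constructor
  · intro h c hc
    apply eps_nondeg hm
    intro r
    obtain ⟨c', hc'⟩ := toR_surj hm (r • toR c)
    have h1 := h c' (by change toR c' ∈ Cs; rw [hc']; exact Cs.smul_mem _ hc)
    rw [key, hc'] at h1
    rw [← h1, Finset.mul_sum]
    simp [mul_assoc]
  · intro h c hc
    rw [key, h c hc, map_zero]

/-! CRT -/

section crt
variable {ι : Type*} [Fintype ι] {m : ℕ} {f : ι → F[X]}
  (hfd : ∀ a, f a ∣ X ^ m - C 1)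

lemma crt_inj (hco : Pairwise (Function.onFun IsCoprime f)) (hdvd : (X ^ m - C 1) ∣ ∏ a, f a)
    (r : AdjoinRoot (X ^ m - C 1 : F[X])) (h : ∀ a, projMod _ (f a) (hfd a) r = 0) : r = 0 := by
  induction r using AdjoinRoot.induction_on with
  | _ P =>
    simp only [projMod_mk, AdjoinRoot.mk_eq_zero] at h ⊢
    exact hdvd.trans (Fintype.prod_dvd_of_coprime hco h)

lemma crt_idem [DecidableEq ι] (hco : Pairwise (Function.onFun IsCoprime f)) (a : ι) :
    ∃ e : AdjoinRoot (X ^ m - C 1 : F[X]), projMod _ (f a) (hfd a) e = 1 ∧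
      ∀ b, b ≠ a → projMod _ (f b) (hfd b) e = 0 := by
  have : IsCoprime (f a) (∏ b ∈ Finset.univ.erase a, f b) :=
    IsCoprime.prod_right fun b hb => hco (Finset.ne_of_mem_erase hb).symm
  obtain ⟨u, v, huv⟩ := this
  refine ⟨AdjoinRoot.mk _ (v * ∏ b ∈ Finset.univ.erase a, f b), ?_, ?_⟩
  · rw [projMod_mk, ← sub_eq_zero, ← map_one (AdjoinRoot.mk (f a)), ← map_sub,
      AdjoinRoot.mk_eq_zero, ← huv]
    exact ⟨-u, by ring⟩
  · intro b hb
    rw [projMod_mk, AdjoinRoot.mk_eq_zero]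
    exact Dvd.dvd.mul_left (Finset.dvd_prod_of_mem f (by simp [hb])) _

lemma mem_const_iff [DecidableEq ι] {ℓ : ℕ} (hm : 0 < m)
    (hco : Pairwise (Function.onFun IsCoprime f)) (hdvd : (X ^ m - C 1) ∣ ∏ a, f a)
    (Cs : Submodule (AdjoinRoot (X ^ m - C 1 : F[X])) (Fin ℓ → AdjoinRoot (X ^ m - C 1 : F[X])))
    (c : Fin m → Fin ℓ → F) :
    c ∈ arrSet Cs ↔ ∀ a, (fun j => projMod _ (f a) (hfd a) (toR c j)) ∈
      constSet (f a) (hfd a) (arrSet Cs) := by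
  constructor
  · intro h a
    exact ⟨c, h, rfl⟩
  · intro h
    choose e he1 he0 using crt_idem (m := m) hfd hco
    choose w hw hwe using h
    have : toR c = ∑ a, e a • toR (w a) := by
      funext j
      rw [← sub_eq_zero]
      apply crt_inj hfd hco hdvd
      intro b
      rw [map_sub, Finset.sum_apply, map_sum, Finset.sum_eq_single b]
      · have := congrFun (hwe b) j
        simp only at this
        rw [Pi.smul_apply, smul_eq_mul, map_mul, he1, one_mul, this, sub_self]
      · intro a _ hab
        rw [Pi.smul_apply, smul_eq_mul, map_mul, he0 a b hab.symm, zero_mul]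
      · simp
    change toR c ∈ Cs
    rw [this]
    exact Submodule.sum_mem _ fun a _ => Cs.smul_mem _ (hw a)

lemma exists_lift [DecidableEq ι] {ℓ : ℕ} (hm : 0 < m)
    (hco : Pairwise (Function.onFun IsCoprime f)) (a : ι) (x : Fin ℓ → AdjoinRoot (f a)) :
    ∃ c : Fin m → Fin ℓ → F, (fun j => projMod _ (f a) (hfd a) (toR c j)) = x ∧
      ∀ b, b ≠ a → (fun j => projMod _ (f b) (hfd b) (toR c j)) = 0 := by
  obtain ⟨e, he1, he0⟩ := crt_idem (m := m) hfd hco a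
  choose u hu using fun j => projMod_surj _ _ (hfd a) (x j)
  obtain ⟨c, hc⟩ := toR_surj hm (e • u)
  refine ⟨c, ?_, ?_⟩
  · funext j
    rw [hc, Pi.smul_apply, smul_eq_mul, map_mul, he1, one_mul, hu]
  · intro b hb
    funext j
    rw [hc, Pi.smul_apply, smul_eq_mul, map_mul, he0 b hb, zero_mul]; rfl

lemma decomp [DecidableEq ι] {ℓ : ℕ} (hm : 0 < m)
    (hco : Pairwise (Function.onFun IsCoprime f)) (hdvd : (X ^ m - C 1) ∣ ∏ a, f a)
    (A B : Set (Fin m → Fin ℓ → F)) (A' B' : ∀ a, Set (Fin ℓ → AdjoinRoot (f a)))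
    (hA : ∀ c, c ∈ A ↔ ∀ a, (fun j => projMod _ (f a) (hfd a) (toR c j)) ∈ A' a)
    (hB : ∀ c, c ∈ B ↔ ∀ a, (fun j => projMod _ (f a) (hfd a) (toR c j)) ∈ B' a)
    (hA0 : ∀ a, 0 ∈ A' a) (hB0 : ∀ a, 0 ∈ B' a) :
    (A = B ↔ ∀ a, A' a = B' a) ∧ (A ∩ B = {0} ↔ ∀ a, A' a ∩ B' a = {0}) := by
  have gen : ∀ (A : Set (Fin m → Fin ℓ → F)) (A' : ∀ a, Set (Fin ℓ → AdjoinRoot (f a)))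
    (hA : ∀ c, c ∈ A ↔ ∀ a, (fun j => projMod _ (f a) (hfd a) (toR c j)) ∈ A' a)
    (hA0 : ∀ a, 0 ∈ A' a) (a : ι) (c : Fin m → Fin ℓ → F)
    (hc : ∀ b, b ≠ a → (fun j => projMod _ (f b) (hfd b) (toR c j)) = 0),
    c ∈ A ↔ (fun j => projMod _ (f a) (hfd a) (toR c j)) ∈ A' a := by
    intro A A' hA hA0 a c hc
    rw [hA]
    refine ⟨fun h => h a, fun h b => ?_⟩
    by_cases hb : b = a
    · subst hb; exact h
    · rw [hc b hb]; exact hA0 b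
  constructor
  · constructor
    · intro h a
      ext x
      obtain ⟨c, hc1, hc0⟩ := exists_lift hfd hm hco a x
      rw [← hc1, ← gen A A' hA hA0 a c hc0, ← gen B B' hB hB0 a c hc0, h]
    · intro h
      ext c
      rw [hA, hB]
      simp only [h]
  · constructor
    · intro h a
      ext x
      simp only [Set.mem_inter_iff, Set.mem_singleton_iff]
      refine ⟨fun hx => ?_, fun hx => hx ▸ ⟨hA0 a, hB0 a⟩⟩
      obtain ⟨c, hc1, hc0⟩ := exists_lift hfd hm hco a x
      rw [← hc1, ← gen A A' hA hA0 a c hc0, ← gen B B' hB hB0 a c hc0] at hx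
      have : c ∈ A ∩ B := hx
      rw [h, Set.mem_singleton_iff] at this
      rw [← hc1, this, toR_zero]
      funext j
      simp
    · intro h
      have hz : ∀ a, (fun j => projMod _ (f a) (hfd a) (toR (0 : Fin m → Fin ℓ → F) j)) = 0 := by
        intro a; funext j; simp [toR_zero]
      ext c
      simp only [Set.mem_inter_iff, Set.mem_singleton_iff]
      constructor
      · rintro ⟨h1, h2⟩
        apply toR_eq_zero hm
        funext j
        apply crt_inj hfd hco hdvd
        intro a
        have : (fun j => projMod _ (f a) (hfd a) (toR c j)) ∈ A' a ∩ B' a :=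
          ⟨(hA c).1 h1 a, (hB c).1 h2 a⟩
        rw [h a] at this
        exact congrFun this j
      · rintro rfl
        rw [hA, hB]
        exact ⟨fun a => by rw [hz]; exact hA0 a, fun a => by rw [hz]; exact hB0 a⟩

end crt

/-! self-reciprocal factors -/

lemma frob_pow_apply [Fintype F] {K : Type*} [CommRing K] [Algebra F K] (k : ℕ) (x : K) :
    (FiniteField.frobeniusAlgHom F K ^ k) x = x ^ Fintype.card F ^ k := by
  induction k with
  | zero => simp
  | succ k ih =>
    rw [pow_succ', AlgHom.mul_apply, ih, FiniteField.coe_frobeniusAlgHom]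
    simp only [← pow_mul, ← pow_succ]

lemma self_rec [Fintype F] {m : ℕ} (hm : 0 < m) (g : F[X]) (hg : Irreducible g)
    (hself : Associated g.reverse g) (hd : g ∣ X ^ m - C 1) :
    (AdjoinRoot.root g) ^ (Fintype.card F ^ (g.natDegree / 2)) = (AdjoinRoot.root g) ^ (m - 1) := by
  have : Fact (Irreducible g) := ⟨hg⟩
  have : FiniteDimensional F (AdjoinRoot g) := (AdjoinRoot.powerBasis hg.ne_zero).finite
  have : Finite (AdjoinRoot g) := Module.finite_of_finite F
  have hfr : Module.finrank F (AdjoinRoot g) = g.natDegree := by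
    rw [(AdjoinRoot.powerBasis hg.ne_zero).finrank]; simp
  have hrm := root_pow_of_dvd g hd
  set α := AdjoinRoot.root g with hα
  have hα0 : α ≠ 0 := by
    intro h; rw [h, zero_pow hm.ne'] at hrm; exact zero_ne_one hrm
  have h1 : α ^ (m - 1) = α⁻¹ := by
    apply eq_inv_of_mul_eq_one_left; rw [← pow_succ, Nat.sub_add_cancel hm, hrm]
  rw [h1]
  have hev : aeval α⁻¹ g = 0 := by
    have h2 : aeval α⁻¹ g.reverse = 0 := by
      let _ := invertibleOfNonzero hα0
      have := (eval₂_reverse_eq_zero_iff (algebraMap F (AdjoinRoot g)) α g).2 (AdjoinRoot.eval₂_root g)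
      rwa [invOf_eq_inv] at this
    obtain ⟨u, hu⟩ := hself
    have h3 := congrArg (aeval α⁻¹) hu
    rw [map_mul, h2, zero_mul] at h3
    exact h3.symm
  let φ : AdjoinRoot g →ₐ[F] AdjoinRoot g := AdjoinRoot.liftAlgHom g (Algebra.ofId F _) α⁻¹ hev
  have hφ : φ α = α⁻¹ := by simp [φ, hα]
  obtain ⟨i, hi⟩ := (FiniteField.bijective_frobeniusAlgHom_pow F (AdjoinRoot g)).2 φ
  simp only at hi
  have hφ2 : φ ^ 2 = 1 := by
    apply AdjoinRoot.algHom_ext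
    rw [pow_two, AlgHom.mul_apply, ← hα, hφ, map_inv₀, hφ, inv_inv]; rfl
  have hdv : g.natDegree ∣ i * 2 := by
    have h5 := (FiniteField.orderOf_frobeniusAlgHom F (AdjoinRoot g)).trans hfr
    refine dvd_trans h5.symm.dvd ?_
    apply orderOf_dvd_of_pow_eq_one
    rw [pow_mul, hi, hφ2]
  have hilt : (i : ℕ) < g.natDegree := hfr ▸ i.2
  rcases Nat.eq_zero_or_pos (i : ℕ) with h0 | h0
  · rw [h0, pow_zero] at hi
    rw [← hi, AlgHom.one_apply] at hφ
    have hsq : α * α = 1 := by nth_rewrite 1 [hφ]; exact inv_mul_cancel₀ hα0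
    rw [← hφ]
    rw [← frob_pow_apply]
    rcases mul_self_eq_one_iff.1 hsq with h | h
    · rw [h, map_one]
    · rw [h, map_neg, map_one]
  · have : (i : ℕ) = g.natDegree / 2 := by
      obtain ⟨k, hk⟩ := hdv
      have : k = 1 := by
        have : k < 2 := by
          by_contra hc
          push Not at hc
          nlinarith
        have : k ≠ 0 := by rintro rfl; omega
        omega
      subst this; omega
    rw [← this, ← frob_pow_apply, hi, hφ]

lemma proj_bar_self [Fintype F] {m : ℕ} (hm : 0 < m) (g : F[X]) (hg : Irreducible g)
    (hself : Associated g.reverse g) (hd : g ∣ X ^ m - C 1)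
    (r : AdjoinRoot (X ^ m - C 1 : F[X])) :
    projMod _ g hd (bar F m r) = projMod _ g hd r ^ (Fintype.card F ^ (g.natDegree / 2)) := by
  have : (projMod _ g hd).comp (bar F m) =
      ((FiniteField.frobeniusAlgHom F (AdjoinRoot g) ^ (g.natDegree / 2) :
        AdjoinRoot g →ₐ[F] AdjoinRoot g) : AdjoinRoot g →+* AdjoinRoot g).comp (projMod _ g hd) := by
    apply AdjoinRoot.ringHom_ext
    · ext x
      simp only [RingHom.comp_apply, bar_of, projMod_of]
      exact (AlgHom.commutes (FiniteField.frobeniusAlgHom F (AdjoinRoot g) ^ (g.natDegree / 2)) x).symm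
    · simp only [RingHom.comp_apply, bar_root, projMod_root, map_pow]
      rw [RingHom.coe_coe, frob_pow_apply, self_rec hm g hg hself hd]
  have h2 := RingHom.congr_fun this r
  simp only [RingHom.comp_apply, RingHom.coe_coe] at h2
  rw [h2, frob_pow_apply]

lemma proj_bar_pair {m : ℕ} (hm : 0 < m) (h h' : F[X]) (hd : h ∣ X ^ m - C 1)
    (hd' : h' ∣ X ^ m - C 1) (σ : AdjoinRoot h' ≃+* AdjoinRoot h)
    (hσF : ∀ x : F, σ (AdjoinRoot.of _ x) = AdjoinRoot.of _ x)
    (hσroot : σ (AdjoinRoot.root h') * AdjoinRoot.root h = 1)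
    (r : AdjoinRoot (X ^ m - C 1 : F[X])) :
    projMod _ h hd (bar F m r) = σ (projMod _ h' hd' r) ∧
    σ (projMod _ h' hd' (bar F m r)) = projMod _ h hd r := by
  have e1 : AdjoinRoot.root h ^ (m - 1) = σ (AdjoinRoot.root h') := by
    have h1 := root_pow_of_dvd h hd
    calc _ = (σ (AdjoinRoot.root h') * AdjoinRoot.root h) * AdjoinRoot.root h ^ (m - 1) := by
          rw [hσroot, one_mul]
      _ = _ := by rw [mul_assoc, ← pow_succ', Nat.sub_add_cancel hm, h1, mul_one]
  have e2 : σ (AdjoinRoot.root h') ^ (m - 1) = AdjoinRoot.root h := by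
    have h1 := congrArg σ (root_pow_of_dvd h' hd')
    rw [map_pow, map_one] at h1
    calc _ = (σ (AdjoinRoot.root h') * AdjoinRoot.root h) * σ (AdjoinRoot.root h') ^ (m - 1) := by
          rw [hσroot, one_mul]
      _ = σ (AdjoinRoot.root h') ^ (m - 1 + 1) * AdjoinRoot.root h := by ring
      _ = _ := by rw [Nat.sub_add_cancel hm, h1, one_mul]
  have t1 : (projMod _ h hd).comp (bar F m) =
      (σ : AdjoinRoot h' →+* AdjoinRoot h).comp (projMod _ h' hd') := by
    apply AdjoinRoot.ringHom_ext
    · ext x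
      simp [bar_of, projMod_of, hσF]
    · simp [bar_root, projMod_root, e1]
  have t2 : ((σ : AdjoinRoot h' →+* AdjoinRoot h).comp (projMod _ h' hd')).comp (bar F m) =
      projMod _ h hd := by
    apply AdjoinRoot.ringHom_ext
    · ext x
      simp [bar_of, projMod_of, hσF]
    · simp [bar_root, projMod_root, e2]
  exact ⟨RingHom.congr_fun t1 r, RingHom.congr_fun t2 r⟩

lemma double_perp {K : Type*} [Field K] {ℓ : ℕ} (W : Submodule K (Fin ℓ → K)) (x : Fin ℓ → K)
    (hx : ∀ y : Fin ℓ → K, (∀ w ∈ W, ∑ j, w j * y j = 0) → ∑ j, y j * x j = 0) : x ∈ W := by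
  by_contra hc
  obtain ⟨φ, h1, h2⟩ := Submodule.exists_le_ker_of_notMem hc
  have hφ : ∀ z, φ z = ∑ j, z j * φ (Pi.single j 1) := by
    intro z
    conv_lhs => rw [← Finset.univ_sum_single z]
    rw [map_sum]
    refine Finset.sum_congr rfl fun j _ => ?_
    have : (Pi.single j (z j) : Fin ℓ → K) = z j • Pi.single j 1 := by
      rw [← Pi.single_smul]; simp
    rw [this, map_smul, smul_eq_mul]
  apply h1
  rw [hφ]
  have := hx (fun j => φ (Pi.single j 1)) (fun w hw => by rw [← hφ]; exact h2 hw)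
  simpa [mul_comm] using this

/-- constituent as a submodule -/
lemma const_submodule {m ℓ : ℕ} (hm : 0 < m) (f : F[X]) (hd : f ∣ X ^ m - C 1)
    (Cs : Submodule (AdjoinRoot (X ^ m - C 1 : F[X])) (Fin ℓ → AdjoinRoot (X ^ m - C 1 : F[X]))) :
    ∃ W : Submodule (AdjoinRoot f) (Fin ℓ → AdjoinRoot f),
      (W : Set (Fin ℓ → AdjoinRoot f)) = constSet f hd (arrSet Cs) := by
  have hmem : ∀ x, x ∈ constSet f hd (arrSet Cs) ↔
      ∃ u ∈ Cs, (fun j => projMod _ f hd (u j)) = x := by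
    intro x
    constructor
    · rintro ⟨c, hc, rfl⟩; exact ⟨toR c, hc, rfl⟩
    · rintro ⟨u, hu, rfl⟩
      obtain ⟨c, rfl⟩ := toR_surj hm u
      exact ⟨c, hu, rfl⟩
  refine ⟨{ carrier := constSet f hd (arrSet Cs), add_mem' := ?_, zero_mem' := ?_, smul_mem' := ?_ },
    rfl⟩
  · intro a b ha hb
    rw [hmem] at *
    obtain ⟨u, hu, rfl⟩ := ha
    obtain ⟨v, hv, rfl⟩ := hb
    exact ⟨u + v, Cs.add_mem hu hv, by funext j; simp⟩
  · rw [hmem]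
    exact ⟨0, Cs.zero_mem, by funext j; simp⟩
  · intro k a ha
    rw [hmem] at *
    obtain ⟨u, hu, rfl⟩ := ha
    obtain ⟨r, rfl⟩ := projMod_surj _ _ hd k
    exact ⟨r • u, Cs.smul_mem _ hu, by funext j; simp⟩

end QCaux

theorem stmt16 (F : Type*) [Field F] [Fintype F] (m ℓ n p : ℕ) (hm : 0 < m)
    -- gcd(m, q) = 1
    (hmq : (m : F) ≠ 0)
    -- the factorization x^m − 1 = g₁⋯g_n · h₁h₁*⋯h_p h_p*
    (g : Fin n → Polynomial F) (h : Fin p → Polynomial F)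
    (hgirr : ∀ i, Irreducible (g i)) (hhirr : ∀ t, Irreducible (h t))
    (hgself : ∀ i, Associated ((g i).reverse) (g i))
    (hhnotself : ∀ t, ¬ Associated ((h t).reverse) (h t))
    (hfact : Associated ((∏ i, g i) * ∏ t, h t * (h t).reverse) (X ^ m - C 1))
    (hgd : ∀ i, g i ∣ X ^ m - C 1) (hhd : ∀ t, h t ∣ X ^ m - C 1)
    (hh'd : ∀ t, (h t).reverse ∣ X ^ m - C 1)
    -- the canonical identification H''_t = H'_t
    (σ : ∀ t, AdjoinRoot ((h t).reverse) ≃+* AdjoinRoot (h t))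
    (hσF : ∀ t (x : F), σ t (AdjoinRoot.of _ x) = AdjoinRoot.of _ x)
    (hσroot : ∀ t, σ t (AdjoinRoot.root ((h t).reverse)) * AdjoinRoot.root (h t) = 1)
    -- C a QC code of index ℓ
    (Cs : Submodule (AdjoinRoot (X ^ m - C 1 : Polynomial F))
      (Fin ℓ → AdjoinRoot (X ^ m - C 1 : Polynomial F))) :
    -- (i) C is Euclidean self-dual iff each C_i is Hermitian self-dual (Euclidean in
    -- the exceptional cases deg g_i = 1) and C''_t = (C'_t)^{⊥e} for all t
    ((arrSet Cs = dualArr Cs) ↔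
      ((∀ i, constSet (g i) (hgd i) (arrSet Cs) =
        {d : Fin ℓ → AdjoinRoot (g i) | ∀ cc ∈ constSet (g i) (hgd i) (arrSet Cs),
          ∑ j, cc j * d j ^ (Fintype.card F ^ ((g i).natDegree / 2)) = 0}) ∧
      (∀ t, constSet ((h t).reverse) (hh'd t) (arrSet Cs) =
        {d : Fin ℓ → AdjoinRoot ((h t).reverse) |
          ∀ cc ∈ constSet (h t) (hhd t) (arrSet Cs),
            ∑ j, cc j * σ t (d j) = 0}))) ∧
    -- (ii) C is Euclidean LCD iff each C_i meets its Hermitian dual trivially and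
    -- C'_t ∩ (C''_t)^{⊥e} = {0}, C''_t ∩ (C'_t)^{⊥e} = {0} for all t
    ((arrSet Cs ∩ dualArr Cs = {0}) ↔
      ((∀ i, constSet (g i) (hgd i) (arrSet Cs) ∩
        {d : Fin ℓ → AdjoinRoot (g i) | ∀ cc ∈ constSet (g i) (hgd i) (arrSet Cs),
          ∑ j, cc j * d j ^ (Fintype.card F ^ ((g i).natDegree / 2)) = 0} = {0}) ∧
      (∀ t, constSet (h t) (hhd t) (arrSet Cs) ∩
        {d : Fin ℓ → AdjoinRoot (h t) |
          ∀ cc ∈ constSet ((h t).reverse) (hh'd t) (arrSet Cs),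
            ∑ j, σ t (cc j) * d j = 0} = {0}) ∧
      (∀ t, constSet ((h t).reverse) (hh'd t) (arrSet Cs) ∩
        {d : Fin ℓ → AdjoinRoot ((h t).reverse) |
          ∀ cc ∈ constSet (h t) (hhd t) (arrSet Cs),
            ∑ j, cc j * σ t (d j) = 0} = {0}))) := by
  classical
  let f : Fin n ⊕ (Fin p ⊕ Fin p) → F[X] := Sum.elim g (Sum.elim h fun t => (h t).reverse)
  have hfd : ∀ a, f a ∣ X ^ m - C 1 := by
    rintro (i | t | t)
    · exact hgd i
    · exact hhd t
    · exact hh'd t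
  have hprod : ∏ a, f a = (∏ i, g i) * ∏ t, h t * (h t).reverse := by
    simp [f, Fintype.prod_sum_type, Finset.prod_mul_distrib]
  have hdvd : (X ^ m - C 1) ∣ ∏ a, f a := by rw [hprod]; exact hfact.symm.dvd
  have hsep : (∏ a, f a).Separable := by
    refine (separable_X_pow_sub_C (1 : F) hmq one_ne_zero).of_dvd ?_
    rw [hprod]; exact hfact.dvd
  have hco : Pairwise (Function.onFun IsCoprime f) := by
    intro a b hab
    refine Separable.isCoprime (hsep.of_dvd ?_)
    rw [← Finset.mul_prod_erase _ f (Finset.mem_univ a)]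
    exact mul_dvd_mul_left _ (Finset.dvd_prod_of_mem f (by simp [hab.symm]))
  let D : ∀ a, Set (Fin ℓ → AdjoinRoot (f a)) := fun a => match a with
    | Sum.inl i => {d : Fin ℓ → AdjoinRoot (g i) | ∀ cc ∈ constSet (g i) (hgd i) (arrSet Cs),
          ∑ j, cc j * d j ^ (Fintype.card F ^ ((g i).natDegree / 2)) = 0}
    | Sum.inr (Sum.inl t) => {d : Fin ℓ → AdjoinRoot (h t) |
          ∀ cc ∈ constSet ((h t).reverse) (hh'd t) (arrSet Cs),
            ∑ j, σ t (cc j) * d j = 0}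
    | Sum.inr (Sum.inr t) => {d : Fin ℓ → AdjoinRoot ((h t).reverse) |
          ∀ cc ∈ constSet (h t) (hhd t) (arrSet Cs),
            ∑ j, cc j * σ t (d j) = 0}
  have hD0 : ∀ a, 0 ∈ D a := by
    rintro (i | t | t)
    · intro cc _
      refine Finset.sum_eq_zero fun j _ => ?_
      have : Fintype.card F ^ ((g i).natDegree / 2) ≠ 0 := pow_ne_zero _ Fintype.card_ne_zero
      change cc j * (0 : AdjoinRoot (g i)) ^ _ = 0
      rw [zero_pow this, mul_zero]
    · intro cc _
      exact Finset.sum_eq_zero fun j _ => mul_zero _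
    · intro cc _
      refine Finset.sum_eq_zero fun j _ => ?_
      change cc j * σ t (0 : AdjoinRoot (h t).reverse) = 0
      rw [map_zero, mul_zero]
  have hA0 : ∀ a, 0 ∈ constSet (f a) (hfd a) (arrSet Cs) := by
    intro a
    obtain ⟨W, hW⟩ := QCaux.const_submodule hm (f a) (hfd a) Cs
    rw [← hW]; exact W.zero_mem
  have hB : ∀ d, d ∈ dualArr Cs ↔
      ∀ a, (fun j => projMod _ (f a) (hfd a) (toR d j)) ∈ D a := by
    intro d
    rw [QCaux.mem_dualArr hm]
    have pr : ∀ (k : F[X]) (hk : k ∣ X ^ m - C 1) (c : Fin m → Fin ℓ → F),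
        projMod _ k hk (∑ j, toR c j * QCaux.bar F m (toR d j)) =
        ∑ j, projMod _ k hk (toR c j) * projMod _ k hk (QCaux.bar F m (toR d j)) := by
      intro k hk c
      rw [map_sum]
      simp only [map_mul]
    have P := fun t => QCaux.proj_bar_pair hm (h t) (h t).reverse (hhd t) (hh'd t) (σ t) (hσF t)
      (hσroot t)
    constructor
    · intro H
      rintro (i | t | t)
      · rintro _ ⟨c, hc, rfl⟩
        have h1 := pr (g i) (hgd i) c
        rw [H c hc, map_zero] at h1
        simp only [QCaux.proj_bar_self hm (g i) (hgirr i) (hgself i) (hgd i)] at h1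
        exact h1.symm
      · rintro _ ⟨c, hc, rfl⟩
        have h1 := congrArg (σ t) (pr _ (hh'd t) c)
        rw [H c hc, map_zero, map_zero, map_sum] at h1
        simp only [map_mul, (P t _).2] at h1
        exact h1.symm
      · rintro _ ⟨c, hc, rfl⟩
        have h1 := pr _ (hhd t) c
        rw [H c hc, map_zero] at h1
        simp only [(P t _).1] at h1
        exact h1.symm
    · intro H c hc
      apply QCaux.crt_inj hfd hco hdvd
      rintro (i | t | t)
      · refine (pr (g i) (hgd i) c).trans ?_
        simp only [QCaux.proj_bar_self hm (g i) (hgirr i) (hgself i) (hgd i)]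
        exact H (Sum.inl i) _ ⟨c, hc, rfl⟩
      · refine (pr _ (hhd t) c).trans ?_
        simp only [(P t _).1]
        exact H (Sum.inr (Sum.inr t)) _ ⟨c, hc, rfl⟩
      · refine (pr _ (hh'd t) c).trans ?_
        apply (σ t).injective
        refine Eq.trans ?_ (map_zero (σ t)).symm
        rw [map_sum]
        simp only [map_mul, (P t _).2]
        exact H (Sum.inr (Sum.inl t)) _ ⟨c, hc, rfl⟩
  obtain ⟨r1, r2⟩ := QCaux.decomp hfd hm hco hdvd (arrSet Cs) (dualArr Cs)
    (fun a => constSet (f a) (hfd a) (arrSet Cs)) D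
    (QCaux.mem_const_iff hfd hm hco hdvd Cs) hB hA0 hD0
  constructor
  · rw [r1]
    constructor
    · intro H
      exact ⟨fun i => H (Sum.inl i), fun t => H (Sum.inr (Sum.inr t))⟩
    · rintro ⟨H1, H2⟩
      rintro (i | t | t)
      · exact H1 i
      · have : Fact (Irreducible (h t)) := ⟨hhirr t⟩
        obtain ⟨W, hW⟩ := QCaux.const_submodule hm (h t) (hhd t) Cs
        have H2t := H2 t
        change constSet (h t) (hhd t) (arrSet Cs) = {d : Fin ℓ → AdjoinRoot (h t) |
          ∀ cc ∈ constSet ((h t).reverse) (hh'd t) (arrSet Cs), ∑ j, σ t (cc j) * d j = 0}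
        rw [H2t, ← hW]
        ext x
        constructor
        · intro hx cc hcc
          have := hcc x hx
          simpa only [mul_comm] using this
        · intro hx
          refine QCaux.double_perp W x fun y hy => ?_
          have := hx (fun j => (σ t).symm (y j)) (fun w hw => by
            simpa only [RingEquiv.apply_symm_apply] using hy w hw)
          simpa only [RingEquiv.apply_symm_apply] using this
      · exact H2 t
  · rw [r2]
    constructor
    · intro H
      exact ⟨fun i => H (Sum.inl i), fun t => H (Sum.inr (Sum.inl t)),
        fun t => H (Sum.inr (Sum.inr t))⟩
    · rintro ⟨H1, H2, H3⟩
      rintro (i | t | t)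
      · exact H1 i
      · exact H2 t
      · exact H3 t
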